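/- For all x > 0, the function g(x) = Ei(-1/x) + x e^{-1/x} is nonnegative. -/

import Mathlib

open MeasureTheory

/-- The exponential integral: for `z < 0`, `Ei z = -∫_{-z}^∞ e^{-t}/t dt`. -/
noncomputable def Ei (z : ℝ) : ℝ := -(∫ t in Set.Ioi (-z), Real.exp (-t) / t)

/-- For all `x > 0`, `g(x) = Ei(-1/x) + x e^{-1/x} ≥ 0`. -/
theorem stmt_3 (x : ℝ) (hx : 0 < x) :
    0 ≤ Ei (-(1/x)) + x * Real.exp (-(1/x)) := by
  have hy : 0 < 1 / x := by positivity
  have hint : IntegrableOn (fun t : ℝ => x * Real.exp (-t)) (Set.Ioi (1/x)) :=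
    (integrableOn_exp_neg_Ioi (1/x)).const_mul x
  have h : (∫ t in Set.Ioi (1/x), Real.exp (-t) / t) ≤
      ∫ t in Set.Ioi (1/x), x * Real.exp (-t) := by
    apply integral_mono_of_nonneg
    · filter_upwards [ae_restrict_mem measurableSet_Ioi] with t ht
      have ht0 : 0 < t := hy.trans ht
      simp only [Pi.zero_apply]
      positivity
    · exact hint
    · filter_upwards [ae_restrict_mem measurableSet_Ioi] with t ht
      have ht0 : 0 < t := hy.trans ht
      have h1 : 1 < t * x := (div_lt_iff₀ hx).1 ht
      rw [div_le_iff₀ ht0]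
      nlinarith [Real.exp_pos (-t)]
  rw [integral_const_mul, integral_exp_neg_Ioi] at h
  unfold Ei
  rw [neg_neg]
  linarith
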